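/- The set N = Σ₂ ∖ (P ∪ P̄) is an open and dense subset of Σ₂. -/

import Mathlib

open Filter MeasureTheory

namespace DoublingHole

/-- One-sided binary sequences (indexed from 0, corresponding to x₁x₂x₃⋯). -/
abbrev Seq : Type := ℕ → Bool

/-- The one-sided shift map σ. -/
def shift (x : Seq) : Seq := fun n => x (n + 1)

/-- Strict lexicographic order ≺ on sequences. -/
def lexLt (x y : Seq) : Prop := ∃ k : ℕ, (∀ i, i < k → x i = y i) ∧ x k < y k

/-- Reflexive lexicographic order ≼ on sequences. -/
def lexLe (x y : Seq) : Prop := lexLt x y ∨ x = y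

/-- The lexicographic subshift Σ_{(α,β)} = {x : β ≼ σⁿx ≼ α for all n ≥ 0}. -/
def lexSubshift (α β : Seq) : Set Seq :=
  {x | ∀ n : ℕ, lexLe β (shift^[n] x) ∧ lexLe (shift^[n] x) α}

/-- The projection π : Σ₂ → [0,1], π(x) = Σ xᵢ 2^{-i}. -/
noncomputable def piMap (x : Seq) : ℝ := ∑' i : ℕ, if x i then (1 : ℝ) / 2 ^ (i + 1) else 0

/-- The mirror image x̄ of a sequence. -/
def mirror (x : Seq) : Seq := fun n => !(x n)

/-- The set P of Parry sequences: α₁ = 1 and σⁿα ≼ α for all n ≥ 1. -/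
def ParryP : Set Seq := {α | α 0 = true ∧ ∀ n, 1 ≤ n → lexLe (shift^[n] α) α}

/-- The set P̄ of mirror images of Parry sequences. -/
def barP : Set Seq := {β | mirror β ∈ ParryP}

/-- Periodic sequences. -/
def PerSet : Set Seq := {x | ∃ k, 1 ≤ k ∧ shift^[k] x = x}

/-- Membership in the lexicographic world LW. -/
def inLW (α β : Seq) : Prop :=
  α ∈ ParryP ∧ β ∈ barP ∧ ∀ n, 1 ≤ n → lexLe β (shift^[n] α) ∧ lexLe (shift^[n] β) α

/-- The doubling map x ↦ 2x (mod 1) on S¹ identified with [0,1). -/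
noncomputable def dbl (x : ℝ) : ℝ := Int.fract (2 * x)

/-- The exceptional set X_{(a,b)} of points whose orbit avoids the hole (a,b). -/
def Xset (a b : ℝ) : Set ℝ :=
  {x | x ∈ Set.Ico (0 : ℝ) 1 ∧ ∀ n : ℕ, dbl^[n] x ∉ Set.Ioo a b}

/-- The attractor Λ_{(a,b)} = [2b-1, 2a] ∩ X_{(a,b)}. -/
def Lam (a b : ℝ) : Set ℝ := Set.Icc (2 * b - 1) (2 * a) ∩ Xset a b

/-- χ(a) = sup{b : X_{(a,b)} is uncountable}. -/
noncomputable def chiFn (a : ℝ) : ℝ :=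
  sSup {b | b ∈ Set.Ico (0 : ℝ) 1 ∧ ¬ (Xset a b).Countable}

/-- The parameter region D₁. -/
def D1 : Set (ℝ × ℝ) :=
  {p | p.1 ∈ Set.Ioo (1/4 : ℝ) (1/2) ∧ p.2 ∈ Set.Ioo (1/2 : ℝ) (3/4) ∧ p.2 ≤ chiFn p.1}

/-- The set S of parameters whose endpoints both fall into the hole. -/
def Sset : Set (ℝ × ℝ) :=
  {p | p ∈ D1 ∧ (∃ n, 1 ≤ n ∧ dbl^[n] p.1 ∈ Set.Ioo p.1 p.2) ∧
        ∃ m, 1 ≤ m ∧ dbl^[m] p.2 ∈ Set.Ioo p.1 p.2}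

/-- The finite word w occurs in (is a factor of) the sequence x. -/
def occursIn (w : List Bool) (x : Seq) : Prop :=
  ∃ i : ℕ, w = List.ofFn fun j : Fin w.length => x (i + (j : ℕ))

/-- The language of a subshift: all finite factors of its elements. -/
def Lang (A : Set Seq) : Set (List Bool) := {w | ∃ x ∈ A, occursIn w x}

/-- A set of sequences is a subshift of finite type if it is defined by
finitely many forbidden words. -/
def IsSFT (A : Set Seq) : Prop :=
  ∃ F : Finset (List Bool), A = {x | ∀ w ∈ F, ¬ occursIn w x}

/-- B_n(A): the admissible words of length n. -/
def wordsOfLen (A : Set Seq) (n : ℕ) : Set (List Bool) :=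
  {w | w.length = n ∧ w ∈ Lang A}

/-- Topological transitivity of a subshift, phrased via its language. -/
def TransitiveShift (A : Set Seq) : Prop :=
  ∀ u ∈ Lang A, ∀ v ∈ Lang A, ∃ t ∈ Lang A, u ++ t ++ v ∈ Lang A

/-- Cyclic rotation of a finite word. -/
def rot (w : List Bool) (k : ℕ) : List Bool := w.drop k ++ w.take k

/-- Lexicographic (dictionary) order on finite words. -/
def listLe (u v : List Bool) : Prop := List.Lex (· < ·) u v ∨ u = v

/-- w = 0-max_w : w starts with 0 and is the lexicographically largest
cyclic permutation of itself starting with 0. -/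
def isZeroMax (w : List Bool) : Prop :=
  w.headD true = false ∧
    ∀ k, k < w.length → (rot w k).headD true = false → listLe (rot w k) w

/-- w = 1-min_w : w starts with 1 and is the lexicographically smallest
cyclic permutation of itself starting with 1. -/
def isOneMin (w : List Bool) : Prop :=
  w.headD false = true ∧
    ∀ k, k < w.length → (rot w k).headD false = true → listLe w (rot w k)

/-- v is the 0-max cyclic permutation of w. -/
def isZeroMaxOf (v w : List Bool) : Prop :=
  (∃ k, k < w.length ∧ v = rot w k) ∧ v.headD true = false ∧
    ∀ k, k < w.length → (rot w k).headD true = false → listLe (rot w k) v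

/-- u is the 1-min cyclic permutation of w. -/
def isOneMinOf (u w : List Bool) : Prop :=
  (∃ k, k < w.length ∧ u = rot w k) ∧ u.headD false = true ∧
    ∀ k, k < w.length → (rot w k).headD false = true → listLe u (rot w k)

/-- The periodic sequence w^∞. -/
def periodicSeq (w : List Bool) : Seq := fun i => w.getD (i % w.length) false

/-- The sequence w followed by x. -/
def wordThen (w : List Bool) (x : Seq) : Seq :=
  fun i => if i < w.length then w.getD i false else x (i - w.length)

/-- Prepend one symbol to a sequence (e.g. 0α, 1β). -/
def consSeq (a : Bool) (x : Seq) : Seq := fun i => if i = 0 then a else x (i - 1)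

/-- A word is balanced if any two factors of equal length have numbers of 1's
differing by at most one. -/
def balanced (w : List Bool) : Prop :=
  ∀ u v : List Bool, u <:+: w → v <:+: w → u.length = v.length →
    ((u.count true : ℤ) - (v.count true : ℤ)).natAbs ≤ 1

/-- A word is cyclically balanced if its square is balanced. -/
def cycBalanced (w : List Bool) : Prop := balanced (w ++ w)

/-- Infinite concatenation of a sequence of (nonempty) finite words. -/
noncomputable def concatSeq (b : ℕ → List Bool) : Seq := fun i =>
  (b (sInf {n : ℕ | i < ∑ k ∈ Finset.range (n + 1), (b k).length})).getD
    (i - ∑ k ∈ Finset.range (sInf {n : ℕ | i < ∑ k ∈ Finset.range (n + 1), (b k).length}), (b k).length)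
    false

/-- (α,β) is renormalisable by the finite words ω and ν:
ω = 0-max_ω, ν = 1-min_ν, (0-max_ν)^∞ ≺ ω^∞, ν^∞ ≺ (1-min_ω)^∞, ℓ(ων) ≥ 3, and
0α = ω ν^{n₁^ν} ω^{n₁^ω} ν^{n₂^ν} ⋯ and 1β = ν ω^{m₁^ω} ν^{m₁^ν} ⋯ with all
exponents in ℕ ∪ {∞}; equivalently 0α (resp. 1β) is an infinite concatenation of
copies of ω and ν whose first two blocks are ω, ν (resp. ν, ω). -/
def RenormalisableBy (α β : Seq) (ω ν : List Bool) : Prop :=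
  isZeroMax ω ∧ isOneMin ν ∧
  (∀ v, isZeroMaxOf v ν → lexLt (periodicSeq v) (periodicSeq ω)) ∧
  (∀ u, isOneMinOf u ω → lexLt (periodicSeq ν) (periodicSeq u)) ∧
  3 ≤ ω.length + ν.length ∧
  (∃ b : ℕ → List Bool, b 0 = ω ∧ b 1 = ν ∧ (∀ k, b k = ω ∨ b k = ν) ∧
    consSeq false α = concatSeq b) ∧
  (∃ c : ℕ → List Bool, c 0 = ν ∧ c 1 = ω ∧ (∀ k, c k = ω ∨ c k = ν) ∧
    consSeq true β = concatSeq c)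

/-- (α,β) is renormalisable by an infinite sequence: either 0α = ω and 1β = νω
with ω infinite and ν = 1-min_ν finite, or 0α = ων and 1β = ν with ν infinite
and ω = 0-max_ω finite. -/
def RenormInfBy (α β : Seq) : Prop :=
  (∃ ν : List Bool, isOneMin ν ∧ consSeq true β = wordThen ν (consSeq false α)) ∨
  (∃ ω : List Bool, isZeroMax ω ∧ consSeq false α = wordThen ω (consSeq true β))

/-- n_α = min{n ≥ 1 : σⁿα ≻ α}. -/
noncomputable def nAlpha (α : Seq) : ℕ := sInf {n | 1 ≤ n ∧ lexLt α (shift^[n] α)}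

/-- The periodic sequence (α₁ ⋯ α_{n-1} 0)^∞. -/
def cutZero (α : Seq) (n : ℕ) : Seq :=
  fun i => if i % n = n - 1 then false else α (i % n)

/-- The periodic sequence (β₁ ⋯ β_{n-1} 1)^∞. -/
def cutOne (β : Seq) (n : ℕ) : Seq :=
  fun i => if i % n = n - 1 then true else β (i % n)

open Classical in
/-- The map ς : Σ₂¹ → Σ₂¹. -/
noncomputable def varsigma (α : Seq) : Seq :=
  if α ∈ ParryP then α else cutZero α (nAlpha α)

/-- The map ς' : Σ₂⁰ → Σ₂⁰, ς'(β) = mirror of ς(β̄). -/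
noncomputable def varsigma' (β : Seq) : Seq := mirror (varsigma (mirror β))

/-- M_α(β) = min{m ≥ 1 : σ^m β ≻ α}. -/
noncomputable def Msub (α β : Seq) : ℕ := sInf {m | 1 ≤ m ∧ lexLt α (shift^[m] β)}

/-- N_β(α) = min{n ≥ 1 : σⁿ α ≺ β}. -/
noncomputable def Nsub (α β : Seq) : ℕ := sInf {n | 1 ≤ n ∧ lexLt (shift^[n] α) β}

/-- ι(α) = (α₁ ⋯ α_{N_β(α)-1} 0)^∞. -/
noncomputable def iotaA (α β : Seq) : Seq := cutZero α (Nsub α β)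

/-- ι(β) = (β₁ ⋯ β_{M_α(β)-1} 1)^∞. -/
noncomputable def iotaB (α β : Seq) : Seq := cutOne β (Msub α β)

/-- ξ_α(β) = (β₁ ⋯ β_{M-1} 1)^∞ with M = M_α(β). -/
noncomputable def xiA (α β : Seq) : Seq := cutOne β (Msub α β)

/-- ξ'_β(α) = (α₁ ⋯ α_{N-1} 0)^∞ with N = N_β(α). -/
noncomputable def xiB (α β : Seq) : Seq := cutZero α (Nsub α β)

/-- A two sided extremal pair. -/
def twoSidedExtremal (α β : Seq) : Prop :=
  (∃ n, 1 ≤ n ∧ lexLt α (shift^[n] β)) ∧ (∃ m, 1 ≤ m ∧ lexLt (shift^[m] α) β)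

/-- A right extremal pair. -/
def rightExtremal (α β : Seq) : Prop :=
  (∀ m, 1 ≤ m → lexLt β (shift^[m] α)) ∧ (∃ n, 1 ≤ n ∧ lexLt α (shift^[n] β))

/-- A left extremal pair. -/
def leftExtremal (α β : Seq) : Prop :=
  (∀ n, 1 ≤ n → lexLt (shift^[n] β) α) ∧ (∃ m, 1 ≤ m ∧ lexLt (shift^[m] α) β)

/-- Dyadic rationals. -/
def IsDyadic (t : ℝ) : Prop := ∃ (z : ℤ) (n : ℕ), t = (z : ℝ) / 2 ^ n

/-- α₁ ⋯ α_n 1^∞. -/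
def onesAfter (α : Seq) (n : ℕ) : Seq := fun i => if i < n then α i else true

end DoublingHole

namespace DoublingHole

theorem shift_iterate_apply (n : ℕ) (x : Seq) (i : ℕ) : shift^[n] x i = x (i + n) := by
  induction n generalizing x with
  | zero => rfl
  | succ n ih =>
    rw [Function.iterate_succ_apply, ih]
    rfl

theorem continuous_shift : Continuous shift :=
  continuous_pi fun n => continuous_apply (n + 1)

theorem continuous_mirror : Continuous mirror :=
  continuous_pi fun n => continuous_of_discreteTopology.comp (continuous_apply n)

theorem lexLe_iff_forall (x y : Seq) :
    lexLe x y ↔ ∀ k, (∀ i, i < k → x i = y i) → x k ≤ y k := by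
  constructor
  · rintro (⟨m, hm, hlt⟩ | rfl) k hk
    · rcases lt_trichotomy k m with h | rfl | h
      · exact (hm k h).le
      · exact hlt.le
      · exact absurd (hk m h) hlt.ne
    · exact le_rfl
  · intro h
    by_cases hxy : x = y
    · exact Or.inr hxy
    · have hne : ∃ k, x k ≠ y k := Function.ne_iff.mp hxy
      have heq : ∀ i, i < Nat.find hne → x i = y i := fun i hi =>
        not_not.mp (Nat.find_min hne hi)
      exact Or.inl ⟨Nat.find hne, heq, lt_of_le_of_ne (h _ heq) (Nat.find_spec hne)⟩

theorem isClosed_lexLe {X : Type*} [TopologicalSpace X] {f g : X → Seq}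
    (hf : Continuous f) (hg : Continuous g) : IsClosed {x | lexLe (f x) (g x)} := by
  simp only [lexLe_iff_forall, Set.ofPred_forall]
  refine isClosed_iInter fun k => ?_
  refine isClosed_imp ?_ ((isClosed_discrete {p : Bool × Bool | p.1 ≤ p.2}).preimage
    (((continuous_apply k).comp hf).prodMk ((continuous_apply k).comp hg)))
  have h : {x | ∀ i, i < k → f x i = g x i} = ⋂ i ∈ Set.Iio k, {x | f x i = g x i} := by
    ext x
    simp
  rw [h]
  refine (Set.finite_Iio k).isOpen_biInter fun i _ => ?_
  exact (isOpen_discrete {p : Bool × Bool | p.1 = p.2}).preimage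
    (((continuous_apply i).comp hf).prodMk ((continuous_apply i).comp hg))

theorem isClosed_ParryP : IsClosed ParryP := by
  have h : ParryP = {α : Seq | α 0 = true} ∩
      ⋂ n, ⋂ (_ : 1 ≤ n), {α : Seq | lexLe (shift^[n] α) α} := by
    ext α
    simp [ParryP]
  rw [h]
  exact (isClosed_eq (continuous_apply 0) continuous_const).inter
    (isClosed_iInter fun n => isClosed_iInter fun _ =>
      isClosed_lexLe (continuous_shift.iterate n) continuous_id)

theorem isClosed_barP : IsClosed barP :=
  isClosed_ParryP.preimage continuous_mirror

/-- The prefix of `x` of length `n + 1`, followed by the opposite of `x 0` and then by `x 0`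
forever. -/
def tailFlip (x : Seq) (n : ℕ) : Seq :=
  fun i => if i ≤ n then x i else if i = n + 1 then !(x 0) else x 0

theorem tendsto_tailFlip (x : Seq) : Tendsto (tailFlip x) atTop (nhds x) := by
  refine tendsto_pi_nhds.mpr fun i => tendsto_const_nhds.congr' ?_
  filter_upwards [eventually_ge_atTop i] with n hn
  simp [tailFlip, hn]

theorem mirror_tailFlip (x : Seq) (n : ℕ) : mirror (tailFlip x n) = tailFlip (mirror x) n := by
  funext i
  simp only [mirror, tailFlip]
  split_ifs <;> rfl

theorem tailFlip_notMem_ParryP (x : Seq) (n : ℕ) : tailFlip x n ∉ ParryP := by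
  rintro ⟨h0, h⟩
  have hx : x 0 = true := by simpa [tailFlip] using h0
  have htail : ∀ i, shift^[n + 2] (tailFlip x n) i = true := fun i => by
    rw [shift_iterate_apply]
    simp only [tailFlip]
    rw [if_neg (by omega), if_neg (by omega), hx]
  have hflip : tailFlip x n (n + 1) = false := by simp [tailFlip, hx]
  rcases h (n + 2) (by omega) with ⟨k, -, hk⟩ | heq
  · rw [htail k] at hk
    exact absurd hk (not_lt_of_ge (Bool.le_true _))
  · have := htail (n + 1)
    rw [heq, hflip] at this
    exact Bool.false_ne_true this

theorem tailFlip_notMem_barP (x : Seq) (n : ℕ) : tailFlip x n ∉ barP := by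
  intro h
  refine tailFlip_notMem_ParryP (mirror x) n ?_
  rw [← mirror_tailFlip]
  exact h

/-- N = Σ₂ ∖ (P ∪ P̄) is open and dense in Σ₂. -/
theorem statement7 : IsOpen (ParryP ∪ barP)ᶜ ∧ Dense (ParryP ∪ barP)ᶜ := by
  refine ⟨(isClosed_ParryP.union isClosed_barP).isOpen_compl, fun x => ?_⟩
  refine mem_closure_of_tendsto (tendsto_tailFlip x) (Eventually.of_forall fun n => ?_)
  rintro (h | h)
  · exact tailFlip_notMem_ParryP x n h
  · exact tailFlip_notMem_barP x n h

end DoublingHole
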